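/- Let (η_k)_{k ∈ ℤ^d} be complex numbers with |η_k| = 1 for all k, and let F : H → H be the bounded linear operator determined by F e_k = η_k e_k for all k ∈ ℤ^d (the time-evolution operator of the Schrödinger equation with constant potential in the Fourier basis). Then (a) ‖F ψ‖_{H^s} = ‖ψ‖_{H^s} for every ψ ∈ H^s; and (b) if moreover the data (w_k)_{|k|∞ ≤ K} is orthonormal and satisfies ‖w_k − F e_k‖ ≤ ε for every |k|∞ ≤ K, then the estimator T satisfies, for every integer q ≥ 1 and every ψ ∈ H^s, ‖T^q ψ − F^q ψ‖ ≤ ‖ψ‖_{H^s} · (ε · γ_K + K^{−s}) · q. -/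

import Mathlib

open scoped ComplexInnerProductSpace
open Finset

noncomputable section

/-- The cube of lattice points `k ∈ ℤ^d` with sup norm `|k|∞ ≤ K`. -/
def cube (d K : ℕ) : Finset (Fin d → ℤ) :=
  Fintype.piFinset fun _ => Finset.Icc (-(K : ℤ)) (K : ℤ)

/-- The Sobolev weight `(1 + |k|₂²)^s`. -/
def weight (d : ℕ) (s : ℝ) (k : Fin d → ℤ) : ℝ :=
  (1 + ∑ i, ((k i : ℝ)) ^ 2) ^ s

variable {H : Type*} [NormedAddCommGroup H] [InnerProductSpace ℂ H] [CompleteSpace H]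

/-- The estimator `T = ∑_{|k|∞ ≤ K} w_k ⊗ e_k`, i.e. `T u = ∑_{|k|∞ ≤ K} ⟨u, e_k⟩ w_k`
(with the Mathlib convention that `⟪·,·⟫` is linear in the second argument, so the paper
inner product `⟨u, e_k⟩` is `⟪e k, u⟫`). -/
def estimator {d : ℕ} (e : HilbertBasis (Fin d → ℤ) ℂ H)
    (w : (Fin d → ℤ) → H) (K : ℕ) : H →L[ℂ] H :=
  ∑ k ∈ cube d K, (innerSL ℂ (e k)).smulRight (w k)

/-- The Sobolev norm `‖ψ‖_{H^s}`. -/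
def sobolevNorm {d : ℕ} (s : ℝ) (e : HilbertBasis (Fin d → ℤ) ℂ H) (ψ : H) : ℝ :=
  Real.sqrt (∑' k, weight d s k * ‖⟪e k, ψ⟫‖ ^ 2)

/-- Membership in the Sobolev space `H^s`. -/
def memSobolev {d : ℕ} (s : ℝ) (e : HilbertBasis (Fin d → ℤ) ℂ H) (ψ : H) : Prop :=
  Summable fun k => weight d s k * ‖⟪e k, ψ⟫‖ ^ 2

/-- `γ_K = (∑_{|k|∞ ≤ K} (1+|k|₂²)^{-s})^{1/2}`. -/
def gammaK (d : ℕ) (s : ℝ) (K : ℕ) : ℝ :=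
  Real.sqrt (∑ k ∈ cube d K, (weight d s k)⁻¹)


set_option linter.unusedSectionVars false

theorem weight_pos (d : ℕ) (s : ℝ) (k : Fin d → ℤ) : 0 < weight d s k := by
  unfold weight; positivity

theorem rpow_two_mul_le_weight {d K : ℕ} {s : ℝ} (hs : 0 ≤ s) {k : Fin d → ℤ}
    (hk : k ∉ cube d K) : (K : ℝ) ^ (2 * s) ≤ weight d s k := by
  simp only [cube, Fintype.mem_piFinset, Finset.mem_Icc, not_forall] at hk
  obtain ⟨i, hi⟩ := hk
  have hsq : (K : ℝ) ^ 2 ≤ (k i : ℝ) ^ 2 := by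
    rw [sq_le_sq, Nat.abs_cast]
    have hle : (K : ℤ) ≤ |k i| := by
      by_contra! h
      exact hi (abs_le.1 h.le)
    exact_mod_cast hle
  have hsum : (k i : ℝ) ^ 2 ≤ ∑ j, (k j : ℝ) ^ 2 :=
    Finset.single_le_sum (f := fun j => (k j : ℝ) ^ 2) (fun _ _ => sq_nonneg _)
      (Finset.mem_univ i)
  rw [Real.rpow_mul (Nat.cast_nonneg K), Real.rpow_two, weight]
  exact Real.rpow_le_rpow (by positivity) (by linarith) hs

theorem HilbertBasis.hasSum_norm_inner_sq {ι : Type*} (e : HilbertBasis ι ℂ H) (x : H) :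
    HasSum (fun k => ‖⟪e k, x⟫‖ ^ 2) (‖x‖ ^ 2) := by
  have h := Complex.hasSum_re (e.hasSum_inner_mul_inner x x)
  convert h using 1
  · ext k
    rw [← inner_conj_symm x (e k), ← Complex.normSq_eq_conj_mul_self, Complex.ofReal_re,
      Complex.normSq_eq_norm_sq]
  · exact norm_sq_eq_re_inner (𝕜 := ℂ) x

section Diagonal

variable {ι : Type*} {e : HilbertBasis ι ℂ H} {η : ι → ℂ} {F : H →L[ℂ] H}

theorem inner_diagonal_apply (hF : ∀ k, F (e k) = η k • e k) (k : ι) (x : H) :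
    ⟪e k, F x⟫ = η k * ⟪e k, x⟫ := by
  classical
  have h : (innerSL ℂ (e k)).comp F = η k • innerSL ℂ (e k) := by
    refine ContinuousLinearMap.ext_on
      (Submodule.dense_iff_topologicalClosure_eq_top.2 e.dense_span) ?_
    rintro _ ⟨l, rfl⟩
    simp only [ContinuousLinearMap.comp_apply, innerSL_apply_apply, hF, inner_smul_right,
      smul_apply, smul_eq_mul, orthonormal_iff_ite.1 e.orthonormal]
    split_ifs with hkl <;> simp [hkl]
  simpa using DFunLike.congr_fun h x

theorem norm_inner_diagonal_apply (hη : ∀ k, ‖η k‖ = 1) (hF : ∀ k, F (e k) = η k • e k)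
    (k : ι) (x : H) : ‖⟪e k, F x⟫‖ = ‖⟪e k, x⟫‖ := by
  rw [inner_diagonal_apply hF, norm_mul, hη, one_mul]

theorem norm_inner_diagonal_pow_apply (hη : ∀ k, ‖η k‖ = 1)
    (hF : ∀ k, F (e k) = η k • e k) (q : ℕ) (k : ι) (x : H) :
    ‖⟪e k, (F ^ q) x⟫‖ = ‖⟪e k, x⟫‖ := by
  induction q with
  | zero => simp
  | succ q ih => rw [pow_succ', mul_apply_eq_comp, norm_inner_diagonal_apply hη hF, ih]

theorem norm_diagonal_apply (hη : ∀ k, ‖η k‖ = 1) (hF : ∀ k, F (e k) = η k • e k) (x : H) :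
    ‖F x‖ = ‖x‖ := by
  have h := e.hasSum_norm_inner_sq (F x)
  simp only [norm_inner_diagonal_apply hη hF] at h
  exact (sq_eq_sq₀ (norm_nonneg _) (norm_nonneg _)).1 (h.unique (e.hasSum_norm_inner_sq x))

end Diagonal

section Sobolev

variable {d : ℕ} {s : ℝ} {e : HilbertBasis (Fin d → ℤ) ℂ H}

theorem sobolevNorm_congr {φ ψ : H} (h : ∀ k, ‖⟪e k, φ⟫‖ = ‖⟪e k, ψ⟫‖) :
    sobolevNorm s e φ = sobolevNorm s e ψ := by
  simp only [sobolevNorm, h]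

theorem memSobolev_congr {φ ψ : H} (h : ∀ k, ‖⟪e k, φ⟫‖ = ‖⟪e k, ψ⟫‖) :
    memSobolev s e φ ↔ memSobolev s e ψ := by
  simp only [memSobolev, h]

theorem sobolevNorm_nonneg (ψ : H) : 0 ≤ sobolevNorm s e ψ := Real.sqrt_nonneg _

theorem sobolevNorm_sq (ψ : H) :
    sobolevNorm s e ψ ^ 2 = ∑' k, weight d s k * ‖⟪e k, ψ⟫‖ ^ 2 :=
  Real.sq_sqrt (tsum_nonneg fun k => mul_nonneg (weight_pos d s k).le (sq_nonneg _))

theorem sum_norm_inner_le {ψ : H} (hψ : memSobolev s e ψ) (K : ℕ) :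
    ∑ k ∈ cube d K, ‖⟪e k, ψ⟫‖ ≤ gammaK d s K * sobolevNorm s e ψ := by
  have hcs := Finset.sum_sq_le_sum_mul_sum_of_sq_le_mul (cube d K)
    (r := fun k => ‖⟪e k, ψ⟫‖) (f := fun k => (weight d s k)⁻¹)
    (g := fun k => weight d s k * ‖⟪e k, ψ⟫‖ ^ 2)
    (fun k _ => (inv_pos.2 (weight_pos d s k)).le)
    (fun k _ => mul_nonneg (weight_pos d s k).le (sq_nonneg _))
    (fun k _ => by rw [inv_mul_cancel_left₀ (weight_pos d s k).ne'])
  have hinv : 0 ≤ ∑ k ∈ cube d K, (weight d s k)⁻¹ :=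
    Finset.sum_nonneg fun k _ => (inv_pos.2 (weight_pos d s k)).le
  refine le_of_sq_le_sq ?_ (mul_nonneg (Real.sqrt_nonneg _) (sobolevNorm_nonneg ψ))
  rw [mul_pow, sobolevNorm_sq, gammaK, Real.sq_sqrt hinv]
  exact hcs.trans (mul_le_mul_of_nonneg_left
    (hψ.sum_le_tsum _ fun k _ => mul_nonneg (weight_pos d s k).le (sq_nonneg _)) hinv)

theorem inner_sub_sum_cube (K : ℕ) (ψ : H) (k : Fin d → ℤ) :
    ⟪e k, ψ - ∑ l ∈ cube d K, ⟪e l, ψ⟫ • e l⟫ = if k ∈ cube d K then 0 else ⟪e k, ψ⟫ := by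
  simp only [inner_sub_right, inner_sum, inner_smul_right,
    orthonormal_iff_ite.1 e.orthonormal, mul_ite, mul_one, mul_zero, Finset.sum_ite_eq]
  split_ifs <;> simp

theorem norm_sub_sum_cube_le {K : ℕ} (hK : 1 ≤ K) (hs : 0 ≤ s) {ψ : H}
    (hψ : memSobolev s e ψ) :
    ‖ψ - ∑ k ∈ cube d K, ⟪e k, ψ⟫ • e k‖ ≤ (K : ℝ) ^ (-s) * sobolevNorm s e ψ := by
  have hK0 : (0 : ℝ) < K := by exact_mod_cast hK
  refine le_of_sq_le_sq ?_ (mul_nonneg (by positivity) (sobolevNorm_nonneg ψ))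
  rw [mul_pow, sobolevNorm_sq]
  refine hasSum_le (fun k => ?_) (e.hasSum_norm_inner_sq _)
    (hψ.hasSum.mul_left (((K : ℝ) ^ (-s)) ^ 2))
  have hw := (weight_pos d s k).le
  rw [inner_sub_sum_cube]
  split_ifs with hk
  · rw [norm_zero, zero_pow two_ne_zero]
    positivity
  · have hone : ((K : ℝ) ^ (-s)) ^ 2 * (K : ℝ) ^ (2 * s) = 1 := by
      rw [← Real.rpow_natCast, ← Real.rpow_mul hK0.le, ← Real.rpow_add hK0]
      norm_num
      ring_nf
      simp
    have hle : 1 ≤ ((K : ℝ) ^ (-s)) ^ 2 * weight d s k := by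
      rw [← hone]
      exact mul_le_mul_of_nonneg_left (rpow_two_mul_le_weight hs hk) (sq_nonneg _)
    rw [← mul_assoc]
    exact le_mul_of_one_le_left (sq_nonneg _) hle

theorem estimator_apply (w : (Fin d → ℤ) → H) (K : ℕ) (u : H) :
    estimator e w K u = ∑ k ∈ cube d K, ⟪e k, u⟫ • w k := by
  simp [estimator]

theorem norm_estimator_apply_le {K : ℕ} {w : (Fin d → ℤ) → H}
    (hw : ∀ k ∈ cube d K, ∀ l ∈ cube d K, ⟪w k, w l⟫ = if k = l then 1 else 0) (u : H) :
    ‖estimator e w K u‖ ≤ ‖u‖ := by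
  refine le_of_sq_le_sq ?_ (norm_nonneg u)
  have hsq : ‖estimator e w K u‖ ^ 2 = ∑ k ∈ cube d K, ‖⟪e k, u⟫‖ ^ 2 := by
    have hin : ⟪estimator e w K u, estimator e w K u⟫
        = ((∑ k ∈ cube d K, ‖⟪e k, u⟫‖ ^ 2 : ℝ) : ℂ) := by
      rw [estimator_apply, sum_inner, Complex.ofReal_sum]
      refine Finset.sum_congr rfl fun k hk => ?_
      rw [inner_sum, Finset.sum_eq_single_of_mem k hk]
      · rw [inner_smul_left, inner_smul_right, hw k hk k hk, if_pos rfl, mul_one,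
          ← Complex.normSq_eq_conj_mul_self, Complex.normSq_eq_norm_sq]
      · intro l hl hlk
        rw [inner_smul_left, inner_smul_right, hw k hk l hl, if_neg hlk.symm, mul_zero, mul_zero]
    rw [norm_sq_eq_re_inner (𝕜 := ℂ), hin]
    exact Complex.ofReal_re _
  rw [hsq]
  exact e.orthonormal.sum_inner_products_le u

theorem norm_estimator_sub_diagonal_le {K : ℕ} (hK : 1 ≤ K) (hs : 0 ≤ s)
    {η : (Fin d → ℤ) → ℂ} (hη : ∀ k, ‖η k‖ = 1) {F : H →L[ℂ] H}
    (hF : ∀ k, F (e k) = η k • e k) {ε : ℝ} (hε : 0 ≤ ε) {w : (Fin d → ℤ) → H}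
    (hw : ∀ k ∈ cube d K, ‖w k - F (e k)‖ ≤ ε) {ψ : H} (hψ : memSobolev s e ψ) :
    ‖estimator e w K ψ - F ψ‖
      ≤ sobolevNorm s e ψ * (ε * gammaK d s K + (K : ℝ) ^ (-s)) := by
  have hsplit : estimator e w K ψ - F ψ = ∑ k ∈ cube d K, ⟪e k, ψ⟫ • (w k - F (e k))
      - F (ψ - ∑ k ∈ cube d K, ⟪e k, ψ⟫ • e k) := by
    simp only [estimator_apply, smul_sub, Finset.sum_sub_distrib, map_sub, map_sum, map_smul]
    abel
  have hdata : ‖∑ k ∈ cube d K, ⟪e k, ψ⟫ • (w k - F (e k))‖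
      ≤ ε * (gammaK d s K * sobolevNorm s e ψ) := calc
    _ ≤ ∑ k ∈ cube d K, ε * ‖⟪e k, ψ⟫‖ := by
      refine norm_sum_le_of_le _ fun k hk => ?_
      rw [norm_smul, mul_comm]
      exact mul_le_mul_of_nonneg_right (hw k hk) (norm_nonneg _)
    _ ≤ _ := by
      rw [← Finset.mul_sum]
      exact mul_le_mul_of_nonneg_left (sum_norm_inner_le hψ K) hε
  have htail := norm_sub_sum_cube_le hK hs hψ
  rw [← norm_diagonal_apply hη hF] at htail
  rw [hsplit]
  refine (norm_sub_le _ _).trans ((add_le_add hdata htail).trans_eq ?_)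
  ring

end Sobolev

/-- for a diagonal unitary evolution `F e_k = η_k e_k` with `|η_k| = 1`:
(a) `F` preserves the Sobolev norm; (b) with orthonormal ε-accurate data, the multi-step
error grows at most linearly in `q`. -/
theorem constant_potential_time_generalization {d K : ℕ} (hd : 1 ≤ d) (hK : 1 ≤ K)
    {s : ℝ} (hs : 0 < s) (e : HilbertBasis (Fin d → ℤ) ℂ H)
    (η : (Fin d → ℤ) → ℂ) (hη : ∀ k, ‖η k‖ = 1)
    (F : H →L[ℂ] H) (hF : ∀ k, F (e k) = η k • e k)
    (ε : ℝ) (hε : 0 ≤ ε) (w : (Fin d → ℤ) → H)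
    (hw_on : ∀ k ∈ cube d K, ∀ l ∈ cube d K, ⟪w k, w l⟫ = if k = l then 1 else 0)
    (hw_close : ∀ k ∈ cube d K, ‖w k - F (e k)‖ ≤ ε) :
    (∀ ψ : H, memSobolev s e ψ → sobolevNorm s e (F ψ) = sobolevNorm s e ψ) ∧
    (∀ q : ℕ, 1 ≤ q → ∀ ψ : H, memSobolev s e ψ →
      ‖(estimator e w K ^ q) ψ - (F ^ q) ψ‖
        ≤ sobolevNorm s e ψ * (ε * gammaK d s K + (K : ℝ) ^ (-s)) * q) := by
  refine ⟨fun ψ _ => sobolevNorm_congr fun k => norm_inner_diagonal_apply hη hF k ψ,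
    fun q _ ψ hψ => ?_⟩
  clear * - hK hs hη hF hε hw_on hw_close hψ
  induction q with
  | zero => simp
  | succ q ih =>
    have hcoeff := fun k => norm_inner_diagonal_pow_apply hη hF q k ψ
    have hstep := norm_estimator_sub_diagonal_le hK hs.le hη hF hε hw_close
      ((memSobolev_congr hcoeff).2 hψ)
    rw [sobolevNorm_congr hcoeff] at hstep
    have hcontr := norm_estimator_apply_le (e := e) hw_on
      ((estimator e w K ^ q) ψ - (F ^ q) ψ)
    have hsplit : (estimator e w K ^ (q + 1)) ψ - (F ^ (q + 1)) ψ
        = estimator e w K ((estimator e w K ^ q) ψ - (F ^ q) ψ)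
          + (estimator e w K ((F ^ q) ψ) - F ((F ^ q) ψ)) := by
      rw [pow_succ', pow_succ', mul_apply_eq_comp, mul_apply_eq_comp,
        map_sub]
      abel
    rw [hsplit]
    refine (norm_add_le _ _).trans ((add_le_add (hcontr.trans ih) hstep).trans_eq ?_)
    push_cast
    ring
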